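/- arXiv:1812.09896 — 2 statements merged into one kernel-verified Lean document; each statement's English description precedes it below -/
import Mathlib

section
/- Let M be a right-angled Coxeter matrix on a type B with Coxeter group W(M). If W(M) contains a subgroup isomorphic to ℤ × ℤ, then there exist four indices i, j, k, l ∈ B forming an induced 4-cycle in M. -/
/-- A Coxeter matrix is *right-angled* if every off-diagonal entry is `0` (meaning `∞`, no
relation imposed) or `2`. -/
def CoxeterMatrix.IsRightAngled {B : Type*} (M : CoxeterMatrix B) : Prop :=
  ∀ i j : B, i ≠ j → M i j = 0 ∨ M i j = 2

/-- Four indices `i, j, k, l` form an *induced 4-cycle* in the Coxeter matrix `M` if they are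
pairwise distinct, cyclically consecutive ones commute (`M i j = M j k = M k l = M l i = 2`)
and the two opposite pairs satisfy no relation (`M i k = 0` and `M j l = 0`). -/
def CoxeterMatrix.InducedFourCycle {B : Type*} (M : CoxeterMatrix B) (i j k l : B) : Prop :=
  (i ≠ j ∧ i ≠ k ∧ i ≠ l ∧ j ≠ k ∧ j ≠ l ∧ k ≠ l) ∧
  M i j = 2 ∧ M j k = 2 ∧ M k l = 2 ∧ M l i = 2 ∧ M i k = 0 ∧ M j l = 0

namespace RightAngledWord

variable {B : Type*} (M : CoxeterMatrix B)

/-- The letter `s` occurs in the word `w`, and every letter before its first occurrence commutes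
with `s`. -/
def IsInitial (s : B) : List B → Prop
  | [] => False
  | t :: w => s = t ∨ (M s t = 2 ∧ IsInitial s w)

/-- No letter of the word can be cancelled against a later occurrence of itself by commutations. -/
def IsIrreducible : List B → Prop
  | [] => True
  | s :: w => ¬ IsInitial M s w ∧ IsIrreducible w

open scoped Classical in
/-- The subword of `w` formed by the letters `i` and `j`. -/
noncomputable def proj (i j : B) (w : List B) : List B :=
  w.filter (fun t ↦ t = i ∨ t = j)

/-- Two words have the same projections to all pairs of non-commuting letters. -/
def ProjEq (u v : List B) : Prop := ∀ i j, M i j ≠ 2 → proj i j u = proj i j v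

section proj

lemma proj_swap (i j : B) (w : List B) : proj i j w = proj j i w := by
  exact List.filter_congr fun t _ ↦ by simp [or_comm]

lemma proj_cons_of_mem {i j t : B} (h : t = i ∨ t = j) (w : List B) :
    proj i j (t :: w) = t :: proj i j w := by
  simp [proj, h]

lemma proj_cons_of_not_mem {i j t : B} (h : ¬ (t = i ∨ t = j)) (w : List B) :
    proj i j (t :: w) = proj i j w := by
  simp [proj, h]

lemma proj_append (i j : B) (u v : List B) : proj i j (u ++ v) = proj i j u ++ proj i j v := by
  simp [proj]

open scoped Classical in
lemma proj_erase (i j s : B) (w : List B) : proj i j (w.erase s) = (proj i j w).erase s := by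
  induction w with
  | nil => simp [proj]
  | cons t w ih =>
    by_cases hst : t = s
    · subst hst
      by_cases h : t = i ∨ t = j
      · simp [proj_cons_of_mem h]
      · rw [proj_cons_of_not_mem h, List.erase_cons_head, List.erase_of_not_mem]
        simp [proj, h]
    · rw [List.erase_cons_tail (by simpa using hst)]
      by_cases h : t = i ∨ t = j
      · rw [proj_cons_of_mem h, proj_cons_of_mem h, List.erase_cons_tail (by simpa using hst), ih]
      · rw [proj_cons_of_not_mem h, proj_cons_of_not_mem h, ih]

open scoped Classical in
lemma proj_erase_of_not_mem {i j s : B} (h : ¬ (s = i ∨ s = j)) (w : List B) :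
    proj i j (w.erase s) = proj i j w := by
  rw [proj_erase, List.erase_of_not_mem]
  simp [proj, h]

open scoped Classical in
lemma count_proj_left (i j : B) (w : List B) : (proj i j w).count i = w.count i := by
  simp [proj, List.count_filter]

end proj

variable {M}

lemma ne_of_eq_two {s t : B} (h : M s t = 2) : s ≠ t := by
  rintro rfl
  simp at h

lemma diag_ne_two (s : B) : M s s ≠ 2 := by simp

open scoped Classical in
lemma ProjEq.perm {u v : List B} (h : ProjEq M u v) : u.Perm v := by
  rw [List.perm_iff_count]
  intro a
  rw [← count_proj_left a a u, h a a (diag_ne_two a), count_proj_left]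

lemma isInitial_iff {s : B} {w : List B} :
    IsInitial M s w ↔ ∀ j, M s j ≠ 2 → (proj s j w).head? = some s := by
  induction w with
  | nil => simpa [IsInitial, proj] using ⟨s, diag_ne_two s⟩
  | cons t w ih =>
    by_cases hst : s = t
    · subst hst
      simp [IsInitial, proj]
    · by_cases h2 : M s t = 2
      · have key : ∀ j, M s j ≠ 2 → proj s j (t :: w) = proj s j w := by
          intro j hj
          apply proj_cons_of_not_mem
          rintro (h | rfl)
          exacts [hst h.symm, hj h2]
        simp only [IsInitial, hst, h2, true_and, false_or, ih]
        exact forall₂_congr fun j hj ↦ by rw [key j hj]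
      · simp only [IsInitial, hst, h2, false_and, false_or, false_iff, not_forall]
        refine ⟨t, h2, ?_⟩
        simp [proj, Ne.symm hst]

lemma ProjEq.isInitial_iff {u v : List B} (h : ProjEq M u v) (s : B) :
    IsInitial M s u ↔ IsInitial M s v := by
  rw [RightAngledWord.isInitial_iff, RightAngledWord.isInitial_iff]
  exact forall₂_congr fun j hj ↦ by rw [h s j hj]

lemma not_mem_pair {i j s t : B} (hij : M i j ≠ 2) (hst : M s t = 2) (hs : s = i ∨ s = j) :
    ¬ (t = i ∨ t = j) := by
  have := ne_of_eq_two hst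
  have := M.symmetric s t
  rcases hs with rfl | rfl <;> rintro (rfl | rfl) <;> simp_all

open scoped Classical in
lemma isInitial_erase {s t : B} (h : M s t = 2) (w : List B) :
    IsInitial M s (w.erase t) ↔ IsInitial M s w := by
  rw [isInitial_iff, isInitial_iff]
  refine forall₂_congr fun j hj ↦ ?_
  rw [proj_erase_of_not_mem (not_mem_pair hj h (.inl rfl))]

open scoped Classical in
lemma IsIrreducible.erase {s : B} {w : List B} (hw : IsIrreducible M w) (hs : IsInitial M s w) :
    IsIrreducible M (w.erase s) ∧ ¬ IsInitial M s (w.erase s) := by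
  induction w with
  | nil => exact hs.elim
  | cons t w ih =>
    by_cases hst : s = t
    · subst hst
      simpa using And.symm hw
    · obtain ⟨h2, hs'⟩ := hs.resolve_left hst
      obtain ⟨h3, h4⟩ := ih hw.2 hs'
      rw [List.erase_cons_tail (by simpa using Ne.symm hst)]
      refine ⟨⟨?_, h3⟩, ?_⟩
      · rw [isInitial_erase (by rw [M.symmetric, h2])]
        exact hw.1
      · rintro (h | h)
        exacts [hst h, h4 h.2]

open scoped Classical in
lemma IsInitial.projEq_cons_erase {s : B} {w : List B} (hs : IsInitial M s w) :
    ProjEq M (s :: w.erase s) w := by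
  have key : ∀ j, M s j ≠ 2 → proj s j (s :: w.erase s) = proj s j w := by
    intro j hj
    have := isInitial_iff.1 hs j hj
    rw [proj_cons_of_mem (.inl rfl), proj_erase]
    cases hp : proj s j w with
    | nil => simp [hp] at this
    | cons t l =>
      obtain rfl : t = s := by simpa [hp] using this
      simp
  intro i j hij
  by_cases h : s = i ∨ s = j
  · rcases h with rfl | rfl
    · exact key j hij
    · rw [proj_swap i, proj_swap i]
      exact key i (by rwa [M.symmetric])
  · rw [proj_cons_of_not_mem h, proj_erase_of_not_mem h]

lemma ProjEq.cons {u v : List B} (h : ProjEq M u v) (s : B) : ProjEq M (s :: u) (s :: v) := by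
  intro i j hij
  by_cases hs : s = i ∨ s = j
  · rw [proj_cons_of_mem hs, proj_cons_of_mem hs, h i j hij]
  · rw [proj_cons_of_not_mem hs, proj_cons_of_not_mem hs, h i j hij]

open scoped Classical in
lemma ProjEq.erase {u v : List B} (h : ProjEq M u v) (s : B) :
    ProjEq M (u.erase s) (v.erase s) := by
  intro i j hij
  rw [proj_erase, proj_erase, h i j hij]

lemma projEq_swap {s t : B} (h : M s t = 2) (w : List B) :
    ProjEq M (s :: t :: w) (t :: s :: w) := by
  intro i j hij
  by_cases hs : s = i ∨ s = j
  · have ht := not_mem_pair hij h hs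
    rw [proj_cons_of_mem hs, proj_cons_of_not_mem ht, proj_cons_of_not_mem ht, proj_cons_of_mem hs]
  · rw [proj_cons_of_not_mem hs]
    by_cases ht : t = i ∨ t = j
    · rw [proj_cons_of_mem ht, proj_cons_of_mem ht, proj_cons_of_not_mem hs]
    · rw [proj_cons_of_not_mem ht, proj_cons_of_not_mem ht, proj_cons_of_not_mem hs]

section action

variable (M) in
open scoped Classical in
/-- Left multiplication of a word by the letter `s`, cancelling `s` if possible. -/
noncomputable def push (s : B) (w : List B) : List B :=
  if IsInitial M s w then w.erase s else s :: w

lemma isIrreducible_push {w : List B} (hw : IsIrreducible M w) (s : B) :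
    IsIrreducible M (push M s w) := by
  unfold push
  split_ifs with h
  exacts [(hw.erase h).1, ⟨h, hw⟩]

lemma projEq_push {u v : List B} (h : ProjEq M u v) (s : B) :
    ProjEq M (push M s u) (push M s v) := by
  unfold push
  rw [h.isInitial_iff s]
  split_ifs
  exacts [h.erase s, h.cons s]

lemma push_push {w : List B} (hw : IsIrreducible M w) (s : B) :
    ProjEq M (push M s (push M s w)) w := by
  by_cases h : IsInitial M s w
  · have h' := (hw.erase h).2
    simpa only [push, h, h', if_true, if_false] using h.projEq_cons_erase
  · have h' : IsInitial M s (s :: w) := .inl rfl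
    simp only [push, h, h', if_true, if_false, List.erase_cons_head]
    exact fun _ _ _ ↦ rfl

lemma isInitial_push {s t : B} (h : M s t = 2) (w : List B) :
    IsInitial M s (push M t w) ↔ IsInitial M s w := by
  unfold push
  split_ifs
  · exact isInitial_erase h w
  · simp [IsInitial, h, ne_of_eq_two h]

open scoped Classical in
lemma push_comm {s t : B} (h : M s t = 2) (w : List B) :
    ProjEq M (push M s (push M t w)) (push M t (push M s w)) := by
  have h' : M t s = 2 := by rwa [M.symmetric]
  have hs' := isInitial_push h w
  have ht' := isInitial_push h' w
  have hst := ne_of_eq_two h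
  by_cases hs : IsInitial M s w <;> by_cases ht : IsInitial M t w <;>
    simp only [hs, ht, iff_true, iff_false] at hs' ht' <;>
    rw [push, push.eq_def (w := push M s w)] <;>
    simp only [hs', ht', if_true, if_false] <;>
    simp only [push, hs, ht, if_true, if_false]
  · rw [List.erase_comm]
    exact fun _ _ _ ↦ rfl
  · rw [List.erase_cons_tail (by simpa using hst.symm)]
    exact fun _ _ _ ↦ rfl
  · rw [List.erase_cons_tail (by simpa using hst)]
    exact fun _ _ _ ↦ rfl
  · exact projEq_swap h w

variable (M) in
/-- Irreducible words up to equality of all projections to pairs of non-commuting letters. -/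
def traceSetoid : Setoid {w : List B // IsIrreducible M w} where
  r u v := ProjEq M u.1 v.1
  iseqv := ⟨fun _ _ _ _ ↦ rfl, fun h i j hij ↦ (h i j hij).symm,
    fun h h' i j hij ↦ (h i j hij).trans (h' i j hij)⟩

variable (M) in
/-- The action of a letter on the irreducible words up to `traceSetoid`. -/
noncomputable def pushEnd (s : B) : Function.End (Quotient (traceSetoid M)) :=
  Quotient.map (fun w ↦ ⟨push M s w.1, isIrreducible_push w.2 s⟩) fun _ _ h ↦ projEq_push h s

lemma pushEnd_mul_self (s : B) : pushEnd M s * pushEnd M s = 1 := by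
  funext q
  induction q using Quotient.inductionOn with
  | h w => exact Quotient.sound (push_push w.2 s)

lemma pushEnd_comm {s t : B} (h : M s t = 2) :
    pushEnd M s * pushEnd M t = pushEnd M t * pushEnd M s := by
  funext q
  induction q using Quotient.inductionOn with
  | h w => exact Quotient.sound (push_comm h w.1)

lemma isLiftable_pushEnd (hra : M.IsRightAngled) : M.IsLiftable (pushEnd M) := by
  intro i j
  by_cases hij : i = j
  · subst hij
    simp [pushEnd_mul_self]
  · rcases hra i j hij with h | h
    · simp [h]
    · rw [h, pow_two]
      nth_rewrite 2 [pushEnd_comm h]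
      rw [mul_assoc, ← mul_assoc (pushEnd M j), pushEnd_mul_self, one_mul, pushEnd_mul_self]

end action

section group

variable {W : Type*} [Group W] (cs : CoxeterSystem M W)

lemma simple_comm {s t : B} (h : M s t = 2) : Commute (cs.simple s) (cs.simple t) := by
  have := cs.simple_mul_simple_pow s t
  rw [h, pow_two, mul_eq_one_iff_eq_inv] at this
  simpa [Commute, SemiconjBy] using this

lemma commute_wordProd {s : B} {w : List B} (h : ∀ t ∈ w, Commute (cs.simple s) (cs.simple t)) :
    Commute (cs.simple s) (cs.wordProd w) := by
  refine Commute.list_prod_right _ _ fun x hx ↦ ?_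
  obtain ⟨t, ht, rfl⟩ := List.mem_map.1 hx
  exact h t ht

open scoped Classical in
lemma IsInitial.wordProd_eq {s : B} {w : List B} (hs : IsInitial M s w) :
    cs.wordProd w = cs.simple s * cs.wordProd (w.erase s) := by
  induction w with
  | nil => exact hs.elim
  | cons t w ih =>
    by_cases hst : s = t
    · subst hst
      simp [cs.wordProd_cons]
    · obtain ⟨h2, hs'⟩ := hs.resolve_left hst
      rw [List.erase_cons_tail (by simpa using Ne.symm hst), cs.wordProd_cons, cs.wordProd_cons,
        ih hs', ← mul_assoc, ← mul_assoc, (simple_comm cs h2).eq]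

lemma ProjEq.wordProd_eq {u v : List B} (h : ProjEq M u v) : cs.wordProd u = cs.wordProd v := by
  classical
  induction u generalizing v with
  | nil => rw [h.perm.nil_eq]
  | cons s u ih =>
    have hs : IsInitial M s v := (h.isInitial_iff s).1 (.inl rfl)
    rw [hs.wordProd_eq cs, cs.wordProd_cons, ih (by simpa using h.erase s)]

lemma IsIrreducible.projEq (hra : M.IsRightAngled) {u v : List B} (hu : IsIrreducible M u)
    (hv : IsIrreducible M v) (h : cs.wordProd u = cs.wordProd v) : ProjEq M u v := by
  let ρ := cs.lift ⟨pushEnd M, isLiftable_pushEnd hra⟩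
  have key : ∀ w (hw : IsIrreducible M w),
      ρ (cs.wordProd w) (Quotient.mk (traceSetoid M) ⟨[], trivial⟩) =
        Quotient.mk (traceSetoid M) ⟨w, hw⟩ := by
    intro w hw
    induction w with
    | nil => simp; rfl
    | cons s w ih =>
      rw [cs.wordProd_cons, map_mul]
      change ρ (cs.simple s) (ρ (cs.wordProd w) _) = _
      rw [ih hw.2, cs.lift_apply_simple (isLiftable_pushEnd hra)]
      refine Quotient.sound ?_
      change ProjEq M (push M s w) (s :: w)
      simp only [push, hw.1, if_false]
      exact fun _ _ _ ↦ rfl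
  exact Quotient.exact ((key u hu).symm.trans ((congrArg (fun x ↦ ρ x _) h).trans (key v hv)))

lemma isIrreducible_of_isReduced {w : List B} (hw : cs.IsReduced w) : IsIrreducible M w := by
  classical
  induction w with
  | nil => trivial
  | cons s w ih =>
    refine ⟨fun hs ↦ ?_, ih (by simpa using hw.drop 1)⟩
    have h1 := hw.eq
    rw [cs.wordProd_cons, hs.wordProd_eq cs, cs.simple_mul_simple_cancel_left] at h1
    have h2 := cs.length_wordProd_le (w.erase s)
    have h3 := List.length_erase_le (a := s) (l := w)
    simp at h1
    omega

lemma isReduced_iff (hra : M.IsRightAngled) {w : List B} :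
    cs.IsReduced w ↔ IsIrreducible M w := by
  refine ⟨isIrreducible_of_isReduced cs, fun hw ↦ ?_⟩
  obtain ⟨v, hv, hvw⟩ := cs.exists_isReduced (cs.wordProd w)
  have := (hw.projEq cs hra (isIrreducible_of_isReduced cs hv) hvw).perm.length_eq
  rw [CoxeterSystem.IsReduced, hvw, hv.eq, this]

end group

section rep

/-- The concatenation of `n` copies of the word `l`. -/
def rep (l : List B) : ℕ → List B
  | 0 => []
  | n + 1 => l ++ rep l n

lemma mem_of_mem_rep {l : List B} {n : ℕ} {t : B} (h : t ∈ rep l n) : t ∈ l := by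
  induction n with
  | zero => simp [rep] at h
  | succ n ih => exact (List.mem_append.1 h).elim id ih

lemma length_rep (l : List B) (n : ℕ) : (rep l n).length = n * l.length := by
  induction n with
  | zero => simp [rep]
  | succ n ih => simp [rep, ih]; ring

lemma proj_rep (i j : B) (l : List B) (n : ℕ) : proj i j (rep l n) = rep (proj i j l) n := by
  induction n with
  | zero => rfl
  | succ n ih => rw [rep, rep, proj_append, ih]

open scoped Classical in
lemma count_rep (i : B) (l : List B) (n : ℕ) : (rep l n).count i = n * l.count i := by
  induction n with
  | zero => simp [rep]
  | succ n ih => simp [rep, ih]; ring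

lemma rep_append_comm {u v : List B} (h : u ++ v = v ++ u) (n : ℕ) :
    rep u n ++ v = v ++ rep u n := by
  induction n with
  | zero => simp [rep]
  | succ n ih => rw [rep, List.append_assoc, ih, ← List.append_assoc, h, List.append_assoc]

lemma rep_eq_rep_of_length {u v : List B} (h : u ++ v = v ++ u) {m n : ℕ}
    (hl : m * u.length = n * v.length) : rep u m = rep v n := by
  have h1 := rep_append_comm (rep_append_comm h m).symm n
  exact (List.append_inj h1 (by rw [length_rep, length_rep, hl])).1.symm

open scoped Classical in
lemma rep_eq_rep_of_count {u v : List B} (h : u ++ v = v ++ u) {m n : ℕ} {i : B}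
    (hi : 0 < u.count i) (hc : m * u.count i = n * v.count i) : rep u m = rep v n := by
  have h1 := congrArg (List.count i)
    (rep_eq_rep_of_length h (m := v.length) (n := u.length) (mul_comm _ _))
  rw [count_rep, count_rep] at h1
  refine rep_eq_rep_of_length h (Nat.eq_of_mul_eq_mul_right hi ?_)
  linear_combination u.length * hc + n * h1.symm

end rep

section straight

lemma isInitial_append {s : B} {u v : List B} :
    IsInitial M s (u ++ v) ↔ IsInitial M s u ∨ ((∀ t ∈ u, M s t = 2) ∧ IsInitial M s v) := by
  induction u with
  | nil => simp [IsInitial]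
  | cons t u ih =>
    simp only [List.cons_append, IsInitial, ih, List.forall_mem_cons]
    tauto

lemma IsIrreducible.append {u v : List B} (hu : IsIrreducible M u) (hv : IsIrreducible M v)
    (h : ∀ s, IsInitial M s u.reverse → ¬ IsInitial M s v) : IsIrreducible M (u ++ v) := by
  induction u with
  | nil => exact hv
  | cons t u ih =>
    simp only [List.reverse_cons, isInitial_append] at h
    refine ⟨fun ht ↦ ?_, ih hu.2 fun s hs ↦ h s (.inl hs)⟩
    rcases isInitial_append.1 ht with ht | ⟨ht, hv⟩
    · exact hu.1 ht
    · exact h t (.inr ⟨by simpa using ht, .inl rfl⟩) hv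

lemma IsInitial.of_rep {s : B} {w : List B} {n : ℕ} (h : IsInitial M s (rep w n)) :
    IsInitial M s w := by
  induction n with
  | zero => exact h.elim
  | succ n ih => exact (isInitial_append.1 h).elim id fun h ↦ ih h.2

lemma IsIrreducible.rep {w : List B} (hw : IsIrreducible M w)
    (h : ∀ s, IsInitial M s w.reverse → ¬ IsInitial M s w) (n : ℕ) :
    IsIrreducible M (rep w n) := by
  induction n with
  | zero => trivial
  | succ n ih => exact hw.append ih fun s hs hs' ↦ h s hs hs'.of_rep

open scoped Classical in
lemma forall_mem_erase_of_isInitial {s : B} {w : List B} (h : IsInitial M s w)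
    (h' : IsInitial M s w.reverse) (hn : ¬ IsInitial M s (w.erase s).reverse) :
    ∀ t ∈ w.erase s, M s t = 2 := by
  induction w with
  | nil => exact h.elim
  | cons t w ih =>
    rw [List.reverse_cons, isInitial_append] at h'
    by_cases hst : s = t
    · subst hst
      rw [List.erase_cons_head] at hn ⊢
      simpa using (h'.resolve_left hn).1
    · obtain ⟨h2, hs⟩ := h.resolve_left hst
      rw [List.erase_cons_tail (by simpa using Ne.symm hst)] at hn ⊢
      rw [List.reverse_cons, isInitial_append, not_or] at hn
      have h3 : IsInitial M s w.reverse :=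
        h'.resolve_right fun h ↦ h.2.elim hst fun h ↦ h.2
      exact List.forall_mem_cons.2 ⟨h2, ih hs h3 hn.1⟩

variable {W : Type*} [Group W] (cs : CoxeterSystem M W)

lemma wordProd_rep (w : List B) (n : ℕ) : cs.wordProd (rep w n) = cs.wordProd w ^ n := by
  induction n with
  | zero => simp [rep]
  | succ n ih => rw [rep, cs.wordProd_append, ih, pow_succ']

/-- A conjugation-invariant set containing a square contains the square of an element whose
length is multiplicative along powers. -/
lemma exists_sq_mem_length_pow (hra : M.IsRightAngled) (S : Set W)
    (hS : ∀ g x, x ∈ S → g * x * g⁻¹ ∈ S) (hne : ∃ x, x ^ 2 ∈ S) :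
    ∃ x, x ^ 2 ∈ S ∧ ∀ n, cs.length (x ^ n) = n * cs.length x := by
  classical
  obtain ⟨x, hx : x ^ 2 ∈ S, hmin⟩ := exists_minimalFor_of_wellFoundedLT (· ^ 2 ∈ S) cs.length hne
  replace hmin : ∀ y, y ^ 2 ∈ S → cs.length x ≤ cs.length y := fun y hy ↦
    (le_total (cs.length y) (cs.length x)).elim (hmin hy) id
  obtain ⟨w, hw, rfl⟩ := cs.exists_isReduced x
  refine ⟨_, hx, fun n ↦ ?_⟩
  have hw' := (isReduced_iff cs hra).1 hw
  suffices h : ∀ s, IsInitial M s w.reverse → ¬ IsInitial M s w by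
    rw [← wordProd_rep, ((isReduced_iff cs hra).2 (hw'.rep h n)).eq, length_rep, hw.eq]
  intro s hs' hs
  have hlen : (w.erase s).length < w.length := by
    have hl := hs.projEq_cons_erase.perm.length_eq
    rw [List.length_cons] at hl
    omega
  have hxs := hs.wordProd_eq cs
  by_cases h : IsInitial M s (w.erase s).reverse
  · have h1 := congrArg (·⁻¹) (h.wordProd_eq cs)
    simp only [cs.wordProd_reverse, inv_inv, mul_inv_rev, cs.inv_simple] at h1
    have h2 : cs.simple s * cs.wordProd w * (cs.simple s)⁻¹ =
        (cs.wordProd ((w.erase s).reverse.erase s))⁻¹ := by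
      rw [hxs, h1]
      simp
    have h3 := hmin _ (by
      rw [conj_pow]
      exact hS (cs.simple s) _ hx)
    rw [h2, cs.length_inv, hw.eq] at h3
    have h4 := cs.length_wordProd_le ((w.erase s).reverse.erase s)
    have h5 := List.length_erase_le (a := s) (l := (w.erase s).reverse)
    rw [List.length_reverse] at h5
    omega
  · have h1 := commute_wordProd cs fun t ht ↦
      simple_comm cs (forall_mem_erase_of_isInitial hs hs' h t ht)
    have h2 := hmin (cs.wordProd (w.erase s)) (by
      rwa [hxs, h1.mul_pow, cs.simple_sq, one_mul] at hx)
    rw [hw.eq] at h2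
    have h3 := cs.length_wordProd_le (w.erase s)
    omega

lemma exists_length_mul_pow_mul {a : W} (ha : ∀ n, cs.length (a ^ n) = n * cs.length a) (b : W) :
    ∃ N, cs.length (b * a ^ N * a) = cs.length (b * a ^ N) + cs.length a := by
  by_contra! h
  have key : ∀ n, cs.length (b * a ^ n) + n ≤ cs.length b + n * cs.length a := by
    intro n
    induction n with
    | zero => simp
    | succ n ih =>
      have h1 := h n
      have h2 := cs.length_mul_le (b * a ^ n) a
      rw [pow_succ, ← mul_assoc, add_mul]
      omega
  have h1 := key (2 * cs.length b + 1)
  have h2 := cs.length_le_length_mul_add_left b (a ^ (2 * cs.length b + 1))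
  rw [ha] at h2
  omega

end straight

section commuting

variable {W : Type*} [Group W] (cs : CoxeterSystem M W)

lemma wordProd_sq_eq_one {w : List B} (h : ∀ s ∈ w, ∀ t ∈ w, s = t ∨ M s t = 2) :
    cs.wordProd w ^ 2 = 1 := by
  induction w with
  | nil => simp
  | cons s w ih =>
    have hc := commute_wordProd cs (s := s) (w := w) fun t ht ↦ by
      rcases h s (by simp) t (by simp [ht]) with rfl | h
      exacts [.refl _, simple_comm cs h]
    rw [cs.wordProd_cons, hc.mul_pow, cs.simple_sq, one_mul]
    exact ih fun s hs t ht ↦ h s (.tail _ hs) t (.tail _ ht)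

/-- If the letters of `w` satisfying `P` commute with the others, and the latter commute among
themselves, then only the former contribute to the square of the element represented by `w`. -/
lemma wordProd_sq_eq_filter {w : List B} (P : B → Prop) [DecidablePred P]
    (h : ∀ s ∈ w, ∀ t ∈ w, P s → ¬ P t → M s t = 2)
    (h' : ∀ s ∈ w, ∀ t ∈ w, ¬ P s → ¬ P t → s = t ∨ M s t = 2) :
    cs.wordProd w ^ 2 = cs.wordProd (w.filter P) ^ 2 := by
  have hsplit : ∀ v : List B, v ⊆ w →
      cs.wordProd v = cs.wordProd (v.filter P) * cs.wordProd (v.filter (¬ P ·)) := by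
    intro v hv
    induction v with
    | nil => simp
    | cons s v ih =>
      obtain ⟨hs, hv⟩ := List.cons_subset.1 hv
      by_cases hP : P s
      · simp only [List.filter_cons, hP, decide_true, not_true, decide_false, if_true,
          cs.wordProd_cons, mul_assoc]
        rw [ih hv]
        simp
      · have hc := commute_wordProd cs (s := s) (w := v.filter P) fun t ht ↦ by
          simp only [List.mem_filter, decide_eq_true_eq] at ht
          exact (simple_comm cs (h t (hv ht.1) s hs ht.2 hP)).symm
        simp only [List.filter_cons, hP, decide_true, not_false_eq_true, decide_false, if_true,
          cs.wordProd_cons]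
        rw [ih hv, ← mul_assoc, hc.eq]
        simp [mul_assoc]
  have hc : Commute (cs.wordProd (w.filter P)) (cs.wordProd (w.filter (¬ P ·))) := by
    refine Commute.list_prod_left _ _ fun x hx ↦ ?_
    obtain ⟨s, hs, rfl⟩ := List.mem_map.1 hx
    refine commute_wordProd cs fun t ht ↦ ?_
    simp only [List.mem_filter, decide_eq_true_eq] at hs ht
    exact simple_comm cs (h s hs.1 t ht.1 hs.2 ht.2)
  rw [hsplit w (List.Subset.refl w), hc.mul_pow, wordProd_sq_eq_one cs (w := w.filter (¬ P ·)),
    mul_one]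
  intro s hs t ht
  simp only [List.mem_filter, decide_eq_true_eq] at hs ht
  exact h' s hs.1 t ht.1 hs.2 ht.2

/-- Without induced 4-cycles, commuting elements `a` and `c` with `a ^ 2 ≠ 1` and
`ℓ (c * a) = ℓ c + ℓ a` are commensurable. -/
lemma exists_pow_eq_pow (hra : M.IsRightAngled)
    (hM : ∀ i j k l, ¬ M.InducedFourCycle i j k l) {a c : W} (hac : c * a = a * c)
    (hl : cs.length (c * a) = cs.length c + cs.length a) (ha : a ^ 2 ≠ 1) :
    ∃ m n, 0 < n ∧ a ^ (2 * m) = c ^ (2 * n) := by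
  classical
  obtain ⟨α, hα, rfl⟩ := cs.exists_isReduced a
  obtain ⟨γ, hγ, rfl⟩ := cs.exists_isReduced c
  have hcomm : ∀ i j, M i j ≠ 2 → proj i j α ++ proj i j γ = proj i j γ ++ proj i j α := by
    intro i j hij
    rw [← proj_append, ← proj_append]
    refine IsIrreducible.projEq cs hra ?_ ?_ ?_ i j hij
    · rw [← isReduced_iff cs hra, CoxeterSystem.IsReduced, cs.wordProd_append, ← hac, hl, hα.eq,
        hγ.eq, List.length_append, add_comm]
    · rw [← isReduced_iff cs hra, CoxeterSystem.IsReduced, cs.wordProd_append, hl, hα.eq,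
        hγ.eq, List.length_append]
    · rw [cs.wordProd_append, cs.wordProd_append, hac]
  obtain ⟨i₀, hi₀, j₀, hj₀, hne, h2⟩ : ∃ i ∈ α, ∃ j ∈ α, i ≠ j ∧ M i j ≠ 2 := by
    by_contra! h
    exact ha (wordProd_sq_eq_one cs fun s hs t ht ↦ or_iff_not_imp_left.2 (h s hs t ht))
  set n := α.count i₀
  set m := γ.count i₀
  have hn0 : 0 < n := List.count_pos_iff.2 hi₀
  let P : B → Prop := fun t ↦ t ∈ α ∧ m * α.count t = n * γ.count t
  have hrep : ∀ i j, M i j ≠ 2 → P i → rep (proj i j α) m = rep (proj i j γ) n := by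
    intro i j hij hi
    apply rep_eq_rep_of_count (hcomm i j hij) (i := i)
    · rw [count_proj_left]
      exact List.count_pos_iff.2 hi.1
    · rw [count_proj_left, count_proj_left, hi.2]
  have hcount : ∀ i j, M i j ≠ 2 → P i → m * α.count j = n * γ.count j := by
    intro i j hij hi
    have := congrArg (List.count j) (hrep i j hij hi)
    rwa [count_rep, count_rep, proj_swap, count_proj_left, proj_swap, count_proj_left] at this
  have hP : ∀ i j, M i j ≠ 2 → P i → (j ∈ α ∨ j ∈ γ) → P j := by
    intro i j hij hi hj
    have h := hcount i j hij hi
    refine ⟨?_, h⟩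
    by_contra hjα
    rw [List.count_eq_zero_of_not_mem hjα, mul_zero, eq_comm, mul_eq_zero] at h
    exact List.count_eq_zero.1 (h.resolve_left hn0.ne') (hj.resolve_left hjα)
  have hPi₀ : P i₀ := ⟨hi₀, mul_comm _ _⟩
  have hPj₀ : P j₀ := hP i₀ j₀ h2 hPi₀ (.inl hj₀)
  have hPcomm : ∀ s t, (t ∈ α ∨ t ∈ γ) → P s → ¬ P t → M s t = 2 := by
    intro s t ht hs hnt
    by_contra h
    exact hnt (hP s t h hs ht)
  have hclique : ∀ s t, (s ∈ α ∨ s ∈ γ) → (t ∈ α ∨ t ∈ γ) → ¬ P s → ¬ P t →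
      s = t ∨ M s t = 2 := by
    intro s t hs ht hPs hPt
    by_contra! h
    have h1 := hPcomm i₀ s hs hPi₀ hPs
    have h3 := hPcomm j₀ s hs hPj₀ hPs
    have h4 := hPcomm j₀ t ht hPj₀ hPt
    have h5 := hPcomm i₀ t ht hPi₀ hPt
    rw [M.symmetric] at h3 h5
    exact hM i₀ s j₀ t ⟨⟨ne_of_eq_two h1, hne, (ne_of_eq_two h5).symm, ne_of_eq_two h3, h.1,
      ne_of_eq_two h4⟩, h1, h3, h4, h5, (hra _ _ hne).resolve_right h2,
      (hra _ _ h.1).resolve_right h.2⟩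
  have hproj : ProjEq M ((rep α m).filter P) ((rep γ n).filter P) := by
    have key : ∀ i j, M i j ≠ 2 → P i →
        proj i j ((rep α m).filter P) = proj i j ((rep γ n).filter P) := by
      intro i j hij hi
      have hfilter : ∀ w : List B, (∀ t ∈ w, t ∈ α ∨ t ∈ γ) →
          proj i j (w.filter P) = proj i j w := by
        intro w hw
        rw [proj, List.filter_filter]
        refine List.filter_congr fun t ht ↦ ?_
        suffices t = i ∨ t = j → P t by simpa using this
        rintro (rfl | rfl)
        exacts [hi, hP i t hij hi (hw t ht)]
      rw [hfilter _ fun t ht ↦ .inl (mem_of_mem_rep ht),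
        hfilter _ fun t ht ↦ .inr (mem_of_mem_rep ht), proj_rep, proj_rep, hrep i j hij hi]
    intro i j hij
    by_cases hi : P i
    · exact key i j hij hi
    by_cases hj : P j
    · rw [proj_swap, key j i (by rwa [M.symmetric]) hj, proj_swap]
    · have hnil : ∀ w : List B, proj i j (w.filter P) = [] := by
        intro w
        rw [proj, List.filter_eq_nil_iff]
        intro t ht
        have ht : P t := by simpa using (List.mem_filter.1 ht).2
        suffices ¬ (t = i ∨ t = j) by simpa using this
        rintro (rfl | rfl)
        exacts [hi ht, hj ht]
      rw [hnil, hnil]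
  refine ⟨m, n, hn0, ?_⟩
  rw [mul_comm 2, mul_comm 2, pow_mul, pow_mul, ← wordProd_rep, ← wordProd_rep cs γ,
    wordProd_sq_eq_filter cs P, wordProd_sq_eq_filter cs (w := rep γ n) P, hproj.wordProd_eq cs]
  · exact fun s _ t ht ↦ hPcomm s t (.inr (mem_of_mem_rep ht))
  · exact fun s hs t ht ↦ hclique s t (.inr (mem_of_mem_rep hs)) (.inr (mem_of_mem_rep ht))
  · exact fun s _ t ht ↦ hPcomm s t (.inl (mem_of_mem_rep ht))
  · exact fun s hs t ht ↦ hclique s t (.inl (mem_of_mem_rep hs)) (.inl (mem_of_mem_rep ht))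

end commuting

end RightAngledWord

/-- If the Coxeter group of a right-angled Coxeter matrix `M` contains a subgroup isomorphic to
`ℤ × ℤ`, then some four indices form an induced 4-cycle in `M`. -/
theorem stmt11 {B : Type*} (M : CoxeterMatrix B) (hra : M.IsRightAngled)
    (h : ∃ H : Subgroup M.Group, Nonempty (H ≃* Multiplicative (ℤ × ℤ))) :
    ∃ i j k l : B, M.InducedFourCycle i j k l := by
  by_contra! hM
  obtain ⟨H, ⟨e⟩⟩ := h
  let cs := M.toCoxeterSystem
  let φ : Multiplicative (ℤ × ℤ) →* M.Group := H.subtype.comp e.symm.toMonoidHom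
  have hφ : Function.Injective φ := Subtype.val_injective.comp e.symm.injective
  obtain ⟨x, ⟨g, z, hz, hx⟩, hlen⟩ := RightAngledWord.exists_sq_mem_length_pow cs hra
    {y | ∃ g z, z ≠ 1 ∧ y = g * φ z * g⁻¹}
    (by
      rintro g _ ⟨g', z, hz, rfl⟩
      exact ⟨g * g', z, hz, by group⟩)
    ⟨φ (.ofAdd (1, 0)), 1, .ofAdd (2, 0), by decide, by
      rw [← map_pow, one_mul, inv_one, mul_one]
      rfl⟩
  let ψ : Multiplicative (ℤ × ℤ) →* M.Group := (MulAut.conj g).toMonoidHom.comp φ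
  have hψ : Function.Injective ψ := (MulAut.conj g).injective.comp hφ
  have hψz : x ^ 2 = ψ z := hx
  let z' : Multiplicative (ℤ × ℤ) := .ofAdd (-z.toAdd.2, z.toAdd.1)
  obtain ⟨N, hN⟩ := RightAngledWord.exists_length_mul_pow_mul cs (a := x ^ 2)
    (fun n ↦ by rw [← pow_mul, hlen, hlen]; ring) (ψ z')
  have hz0 : 0 < z.toAdd.1 ^ 2 + z.toAdd.2 ^ 2 := by
    by_contra! h
    refine hz (Multiplicative.toAdd.injective (Prod.ext ?_ ?_))
    · exact pow_eq_zero_iff two_ne_zero |>.1 (by nlinarith)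
    · exact pow_eq_zero_iff two_ne_zero |>.1 (by nlinarith)
  rw [hψz, ← map_pow, ← map_mul] at hN
  obtain ⟨m, n, hn, hmn⟩ := RightAngledWord.exists_pow_eq_pow cs hra hM
    (by rw [← map_mul, ← map_mul, mul_comm]) hN (by
      rw [← map_pow, Ne, map_eq_one_iff ψ hψ]
      intro h
      have h1 := congrArg (fun y ↦ (Multiplicative.toAdd y).1) h
      have h2 := congrArg (fun y ↦ (Multiplicative.toAdd y).2) h
      simp at h1 h2
      simp [h1, h2] at hz0)
  rw [← map_pow, ← map_pow] at hmn
  have h := hψ hmn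
  have h1 := congrArg (fun y ↦ (Multiplicative.toAdd y).1) h
  have h2 := congrArg (fun y ↦ (Multiplicative.toAdd y).2) h
  simp [z'] at h1 h2
  have hn' : (0 : ℤ) < n := by exact_mod_cast hn
  have h3 : 2 * ((n : ℤ) * (z.toAdd.1 ^ 2 + z.toAdd.2 ^ 2)) = 0 := by
    linear_combination z.toAdd.2 * h1 - z.toAdd.1 * h2
  replace h3 := (mul_eq_zero.1 h3).resolve_left two_ne_zero
  exact (mul_pos hn' hz0).ne' h3
end

section
/- Let M be a right-angled Coxeter matrix on a type B with Coxeter group W(M). Then W(M) contains a subgroup isomorphic to ℤ × ℤ if and only if there exist four indices i, j, k, l ∈ B forming an induced 4-cycle in M. -/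
namespace CoxeterMatrix

/-- For a right-angled Coxeter matrix, a family of involutions is liftable as soon as its members
commute whenever the matrix prescribes it. -/
theorem IsRightAngled.isLiftable {B G : Type*} [Monoid G] {M : CoxeterMatrix B}
    (hra : M.IsRightAngled) {f : B → G} (hsq : ∀ i, f i * f i = 1)
    (hcomm : ∀ i j, M i j = 2 → f i * f j = f j * f i) : M.IsLiftable f := by
  intro i j
  by_cases hij : i = j
  · subst hij
    simp [hsq]
  · rcases hra i j hij with h | h
    · simp [h]
    · rw [h, pow_two]
      nth_rw 2 [hcomm i j h]
      rw [mul_assoc, ← mul_assoc (f j), hsq, one_mul, hsq]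

end CoxeterMatrix

namespace CoxeterSystem

variable {B W : Type*} [Group W] {M : CoxeterMatrix B} (cs : CoxeterSystem M W)

theorem simple_mul_comm_of_eq_two {i j : B} (h : M i j = 2) :
    cs.simple i * cs.simple j = cs.simple j * cs.simple i := by
  have h1 := cs.simple_mul_simple_pow i j
  rw [h, pow_two, mul_eq_one_iff_eq_inv, mul_inv_rev, cs.inv_simple, cs.inv_simple] at h1
  exact h1

/-- The `ZMod 2`-valued inversion cocycle of a Coxeter system: `η w g = 1` if and only if `g` is a
left inversion of `w`. -/
structure InversionCocycle where
  /-- The underlying function. -/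
  toFun : W → W → ZMod 2
  map_simple_self : ∀ i, toFun (cs.simple i) (cs.simple i) = 1
  map_simple_of_ne : ∀ i g, g ≠ cs.simple i → toFun (cs.simple i) g = 0
  map_mul : ∀ v w g, toFun (v * w) g = toFun v g + toFun w (v⁻¹ * g * v)

theorem nonempty_inversionCocycle (hra : M.IsRightAngled) : Nonempty cs.InversionCocycle := by
  classical
  let f : B → Function.End (W × ZMod 2) := fun i p =>
    (cs.simple i * p.1 * cs.simple i, p.2 + if p.1 = cs.simple i then 1 else 0)
  have hf : M.IsLiftable f := by
    refine hra.isLiftable (fun i => ?_) (fun i j hij => ?_)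
    · funext ⟨g, e⟩
      have h1 : cs.simple i * g * cs.simple i = cs.simple i ↔ g = cs.simple i := by
        rw [mul_eq_right, mul_eq_one_iff_eq_inv', cs.inv_simple]
      have h2 : ∀ x : ZMod 2, x + x = 0 := by decide
      refine Prod.ext ?_ ?_
      · change cs.simple i * (cs.simple i * g * cs.simple i) * cs.simple i = g
        simp [mul_assoc]
      · change (e + if g = cs.simple i then 1 else 0) +
          (if cs.simple i * g * cs.simple i = cs.simple i then 1 else 0) = e
        rw [if_congr h1 rfl rfl, add_assoc, h2, add_zero]
    · have hc := cs.simple_mul_comm_of_eq_two hij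
      have key : ∀ i j : B, cs.simple i * cs.simple j = cs.simple j * cs.simple i →
          ∀ g : W, cs.simple j * g * cs.simple j = cs.simple i ↔ g = cs.simple i := by
        intro i j hc g
        rw [← eq_mul_inv_iff_mul_eq, cs.inv_simple, hc, mul_right_inj]
      funext ⟨g, e⟩
      change ((_, _) : W × ZMod 2) = (_, _)
      refine Prod.ext ?_ ?_
      · change cs.simple i * (cs.simple j * g * cs.simple j) * cs.simple i =
          cs.simple j * (cs.simple i * g * cs.simple i) * cs.simple j
        simp only [← mul_assoc, hc]
        simp only [mul_assoc, hc]
      · simp only [f, key i j hc, key j i hc.symm]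
        ring
  let F : W →* Function.End (W × ZMod 2) := cs.lift ⟨f, hf⟩
  have hFs : ∀ i p, F (cs.simple i) p =
      (cs.simple i * p.1 * cs.simple i, p.2 + if p.1 = cs.simple i then 1 else 0) := by
    intro i p
    rw [show F (cs.simple i) = f i from cs.lift_apply_simple hf i]
  have hFm : ∀ v w p, F (v * w) p = F v (F w p) := fun v w p => by rw [map_mul]; rfl
  have hF : ∀ w g e, F w (g, e) = (w * g * w⁻¹, e + (F w (g, 0)).2) := by
    intro w
    refine cs.simple_induction_left
      (p := fun w => ∀ g e, F w (g, e) = (w * g * w⁻¹, e + (F w (g, 0)).2)) w ?_ ?_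
    · intro g e
      simp only [_root_.map_one]
      change (g, e) = (1 * g * 1⁻¹, e + 0)
      simp
    · intro w i ih g e
      rw [hFm, hFm, ih g e, ih g 0, hFs, hFs]
      simp [mul_assoc, add_assoc]
  refine ⟨⟨fun w g => (F w⁻¹ (g, 0)).2, fun i => ?_, fun i g hg => ?_, fun v w g => ?_⟩⟩
  · simp [hFs]
  · simp [hFs, hg]
  · rw [mul_inv_rev, hFm, hF v⁻¹, hF w⁻¹]
    simp

namespace InversionCocycle

variable {cs}

instance : CoeFun cs.InversionCocycle fun _ => W → W → ZMod 2 := ⟨toFun⟩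

variable (η : cs.InversionCocycle)

theorem eq_zero_or_eq_one (w g : W) : η w g = 0 ∨ η w g = 1 := by
  generalize η w g = x
  revert x
  decide

theorem map_one (g : W) : η 1 g = 0 := by
  have h := η.map_mul 1 1 g
  simpa using h

theorem map_inv (w g : W) : η w⁻¹ g = η w (w * g * w⁻¹) := by
  have h := η.map_mul w w⁻¹ (w * g * w⁻¹)
  rw [mul_inv_cancel, η.map_one] at h
  have e : w⁻¹ * (w * g * w⁻¹) * w = g := by group
  rw [e] at h
  have h2 : ∀ x y : ZMod 2, 0 = x + y → y = x := by decide
  exact h2 _ _ h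

theorem eq_count_leftInvSeq [DecidableEq W] (ω : List B) (g : W) :
    η (cs.wordProd ω) g = ((cs.leftInvSeq ω).count g : ZMod 2) := by
  induction ω generalizing g with
  | nil => simp [η.map_one]
  | cons i ω ih =>
    rw [cs.wordProd_cons, η.map_mul, ih, leftInvSeq, List.count_cons]
    have h1 : (List.map (MulAut.conj (cs.simple i)) (cs.leftInvSeq ω)).count g =
        (cs.leftInvSeq ω).count ((cs.simple i)⁻¹ * g * cs.simple i) := by
      have e : g = MulAut.conj (cs.simple i) ((cs.simple i)⁻¹ * g * cs.simple i) := by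
        simp [mul_assoc]
      nth_rw 1 [e]
      exact List.count_map_of_injective _ _ (MulAut.conj (cs.simple i)).injective _
    rw [h1]
    by_cases hg : g = cs.simple i
    · subst hg
      simp [η.map_simple_self, add_comm]
    · have hg' : ¬ cs.simple i = g := fun h => hg h.symm
      simp [η.map_simple_of_ne i g hg, hg']

theorem eq_one_iff_mem_leftInvSeq {ω : List B} (hω : cs.IsReduced ω) (g : W) :
    η (cs.wordProd ω) g = 1 ↔ g ∈ cs.leftInvSeq ω := by
  classical
  rw [η.eq_count_leftInvSeq, (CoxeterSystem.IsReduced.nodup_leftInvSeq cs hω).count]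
  split_ifs with h <;> simp [h]

theorem finite_setOf_eq_one (w : W) : {g | η w g = 1}.Finite := by
  obtain ⟨ω, hω, rfl⟩ := cs.exists_isReduced w
  simp only [η.eq_one_iff_mem_leftInvSeq hω]
  exact List.finite_toSet _

theorem length_le_card (w : W) (S : Finset W) (hS : ∀ g, η w g = 1 → g ∈ S) :
    cs.length w ≤ S.card := by
  classical
  obtain ⟨ω, hω, rfl⟩ := cs.exists_isReduced w
  rw [hω.eq, ← cs.length_leftInvSeq ω,
    ← List.toFinset_card_of_nodup (CoxeterSystem.IsReduced.nodup_leftInvSeq cs hω)]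
  refine Finset.card_le_card fun g hg => hS g ?_
  rw [η.eq_one_iff_mem_leftInvSeq hω]
  simpa using hg

theorem length_mul_lt {w g : W} (h : η w g = 1) : cs.length (g * w) < cs.length w := by
  obtain ⟨ω, hω, rfl⟩ := cs.exists_isReduced w
  rw [η.eq_one_iff_mem_leftInvSeq hω] at h
  exact (cs.isLeftInversion_of_mem_leftInvSeq hω h).2

theorem isReflection {w g : W} (h : η w g = 1) : cs.IsReflection g := by
  obtain ⟨ω, hω, rfl⟩ := cs.exists_isReduced w
  rw [η.eq_one_iff_mem_leftInvSeq hω] at h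
  exact cs.isReflection_of_mem_leftInvSeq ω h

theorem eq_one_of_isLeftDescent {w : W} {i : B} (h : cs.IsLeftDescent w i) :
    η w (cs.simple i) = 1 := by
  refine (η.eq_zero_or_eq_one _ _).resolve_left fun h0 => ?_
  have h1 : η (cs.simple i * w) (cs.simple i) = 1 := by
    rw [η.map_mul, η.map_simple_self]
    simp [h0]
  have h2 := η.length_mul_lt h1
  rw [cs.simple_mul_simple_cancel_left] at h2
  exact lt_asymm h h2

theorem exists_simple_eq_one {w : W} (hw : w ≠ 1) :
    ∃ i, η w (cs.simple i) = 1 ∧ cs.length (cs.simple i * w) < cs.length w := by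
  obtain ⟨i, hi⟩ := cs.exists_leftDescent_of_ne_one hw
  exact ⟨i, η.eq_one_of_isLeftDescent hi, hi⟩

end InversionCocycle

end CoxeterSystem
namespace CoxeterSystem

variable {B W : Type*} [Group W] {M : CoxeterMatrix B} {cs : CoxeterSystem M W}

/-- Two simple reflections of a right-angled Coxeter group with no relation between them generate
an infinite dihedral group: the reflections `(s i * s j) ^ n * s i` are pairwise distinct. -/
theorem zpow_mul_simple_injective (cs : CoxeterSystem M W) (hra : M.IsRightAngled) {i j : B}
    (hij : i ≠ j) (h0 : M i j = 0) :
    Function.Injective fun n : ℤ => (cs.simple i * cs.simple j) ^ n * cs.simple i := by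
  classical
  let f : B → DihedralGroup 0 := fun b =>
    if b = i then .sr 0 else if b = j then .sr 1 else 1
  have hji : M j i = 0 := by rw [M.symmetric]; exact h0
  have hf : M.IsLiftable f := by
    refine hra.isLiftable (fun b => ?_) (fun b c hbc => ?_)
    · simp only [f]
      split_ifs <;> simp
    · simp only [f]
      split_ifs with h1 h2 h3 h4 h5 h6 <;> subst_vars <;> simp_all
  have hi : cs.lift ⟨f, hf⟩ (cs.simple i) = .sr 0 := by simp [f]
  have hj : cs.lift ⟨f, hf⟩ (cs.simple j) = .sr 1 := by simp [f, hij.symm]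
  intro m n hmn
  have h := congrArg (cs.lift ⟨f, hf⟩) (mul_right_cancel hmn)
  simp only [map_zpow, map_mul, hi, hj, DihedralGroup.sr_mul_sr, sub_zero,
    DihedralGroup.r_one_zpow, DihedralGroup.r.injEq] at h
  exact h

namespace InversionCocycle

variable (η : cs.InversionCocycle)

/-- The reflections in an infinite dihedral standard parabolic subgroup which are left inversions
of a given element form an initial segment of one of the two ends of the chain of reflections. -/
theorem exists_int_forall_zpow_mul_simple (hra : M.IsRightAngled) {i j : B} (hij : i ≠ j)
    (h0 : M i j = 0) (x : W) :
    ∃ d : ℤ, ∀ n : ℤ, η x ((cs.simple i * cs.simple j) ^ n * cs.simple i) = 1 ↔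
      (0 ≤ n ∧ n < d ∨ d ≤ n ∧ n < 0) := by
  have hinj := cs.zpow_mul_simple_injective hra hij h0
  set τ : ℤ → W := fun n => (cs.simple i * cs.simple j) ^ n * cs.simple i with hτ
  change ∃ d : ℤ, ∀ n : ℤ, η x (τ n) = 1 ↔ _
  have hτi : cs.simple i = τ 0 := by simp [hτ]
  have hτj : cs.simple j = τ (-1) := by simp [hτ]
  have hinv : (cs.simple i * cs.simple j)⁻¹ = cs.simple i * (cs.simple i * cs.simple j) *
    (cs.simple i)⁻¹ := by simp
  have hflip : ∀ n : ℤ, cs.simple i * (cs.simple i * cs.simple j) ^ n =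
      (cs.simple i * cs.simple j) ^ (-n) * cs.simple i := by
    intro n
    rw [zpow_neg, ← inv_zpow, hinv, conj_zpow]
    simp
  have hconj : ∀ m n : ℤ, (τ m)⁻¹ * τ n * τ m = τ (2 * m - n) := by
    intro m n
    simp only [hτ]
    rw [mul_inv_rev, cs.inv_simple, ← zpow_neg]
    calc _ = cs.simple i * ((cs.simple i * cs.simple j) ^ (-m) * (cs.simple i * cs.simple j) ^ n) *
          (cs.simple i * (cs.simple i * cs.simple j) ^ m * cs.simple i) := by simp only [mul_assoc]
      _ = (cs.simple i * cs.simple j) ^ (m - n) * (cs.simple i * cs.simple i) *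
          (cs.simple i * cs.simple j) ^ m * cs.simple i := by
        rw [← zpow_add, hflip, show -(-m + n) = m - n by ring]
        simp only [mul_assoc]
      _ = _ := by
        rw [cs.simple_mul_simple_self, mul_one, ← zpow_add]
        congr 2
        ring
  let Q : W → Prop := fun x => ∃ d : ℤ, ∀ n : ℤ, η x (τ n) = 1 ↔
    (0 ≤ n ∧ n < d ∨ d ≤ n ∧ n < 0)
  have hleft : ∀ (b : B) (k : ℤ), cs.simple b = τ k → k = 0 ∨ k = -1 → ∀ z, Q z →
      Q (cs.simple b * z) := by
    rintro b k hb hk z ⟨d, hd⟩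
    refine ⟨2 * k + 1 - d, fun n => ?_⟩
    rw [η.map_mul]
    nth_rw 2 3 [hb]
    rw [hconj]
    have hd' := hd (2 * k - n)
    rcases eq_or_ne n k with rfl | hn
    · rw [← hb, η.map_simple_self]
      rcases η.eq_zero_or_eq_one z (τ (2 * n - n)) with h | h <;> rw [h] at hd' ⊢
      · simp only [zero_ne_one, false_iff] at hd'
        simp only [add_zero, true_iff]
        omega
      · simp only [true_iff] at hd'
        simp only [show (1 + 1 : ZMod 2) = 0 from rfl, zero_ne_one, false_iff]
        omega
    · rw [η.map_simple_of_ne b _ (by rw [hb]; exact hinj.ne hn), zero_add, hd']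
      omega
  have hi : ∀ z, Q z → Q (cs.simple i * z) := hleft i 0 hτi (.inl rfl)
  have hj : ∀ z, Q z → Q (cs.simple j * z) := hleft j (-1) hτj (.inr rfl)
  have hc : ∀ (n : ℤ) z, Q z → Q ((cs.simple i * cs.simple j) ^ n * z) := by
    intro n
    induction n using Int.induction_on with
    | zero => simp
    | succ n ih =>
      intro z hz
      rw [zpow_add_one, mul_assoc, mul_assoc]
      exact ih _ (hi _ (hj _ hz))
    | pred n ih =>
      intro z hz
      rw [zpow_sub_one, mul_inv_rev, cs.inv_simple, cs.inv_simple, mul_assoc, mul_assoc]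
      exact ih _ (hj _ (hi _ hz))
  refine cs.simple_induction_right (p := Q) x ⟨0, fun n => ?_⟩ fun y b hy => ?_
  · simp only [η.map_one, zero_ne_one, false_iff]
    omega
  · by_cases hb : ∃ m, y * cs.simple b * y⁻¹ = τ m
    · obtain ⟨m, hm⟩ := hb
      rw [show y * cs.simple b = τ m * y by rw [← hm]; simp]
      simp only [hτ]
      rw [mul_assoc]
      exact hc m _ (hi _ hy)
    · obtain ⟨d, hd⟩ := hy
      refine ⟨d, fun n => ?_⟩
      rw [η.map_mul, η.map_simple_of_ne, add_zero, hd]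
      intro h
      exact hb ⟨n, by rw [← h]; group⟩

theorem eq_two_of_eq_one (hra : M.IsRightAngled) {i j : B} (hij : i ≠ j) {x : W}
    (hi : η x (cs.simple i) = 1) (hj : η x (cs.simple j) = 1) : M i j = 2 := by
  refine (hra i j hij).resolve_left fun h0 => ?_
  obtain ⟨d, hd⟩ := η.exists_int_forall_zpow_mul_simple hra hij h0 x
  have h1 := (hd 0).1 (by simpa using hi)
  have h2 := (hd (-1)).1 (by simpa using hj)
  omega

end InversionCocycle

end CoxeterSystem
namespace CoxeterSystem.InversionCocycle

variable {B W : Type*} [Group W] {M : CoxeterMatrix B} {cs : CoxeterSystem M W}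
variable (η : cs.InversionCocycle)

theorem eq_zero_of_mem_closure {S : Set B} {G : Subgroup W} (hS : ∀ b ∈ S, cs.simple b ∈ G)
    {w : W} (hw : w ∈ Subgroup.closure (cs.simple '' S)) {g : W} (hg : g ∉ G) : η w g = 0 := by
  have hconj : ∀ x ∈ G, ∀ g ∉ G, x * g * x⁻¹ ∉ G := by
    intro x hx g hg h
    refine hg ?_
    have := G.mul_mem (G.mul_mem (G.inv_mem hx) h) hx
    simpa [mul_assoc] using this
  have key : w ∈ G ∧ ∀ g ∉ G, η w g = 0 := by
    induction hw using Subgroup.closure_induction with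
    | mem x hx =>
      obtain ⟨b, hb, rfl⟩ := hx
      refine ⟨hS b hb, fun g hg => η.map_simple_of_ne b g ?_⟩
      rintro rfl
      exact hg (hS b hb)
    | one => exact ⟨G.one_mem, fun g _ => η.map_one g⟩
    | mul x y _ _ hx hy =>
      refine ⟨G.mul_mem hx.1 hy.1, fun g hg => ?_⟩
      rw [η.map_mul, hx.2 g hg, hy.2 _ ?_, add_zero]
      have := hconj x⁻¹ (G.inv_mem hx.1) g hg
      simpa using this
    | inv x _ hx =>
      exact ⟨G.inv_mem hx.1, fun g hg => by rw [η.map_inv, hx.2 _ (hconj x hx.1 g hg)]⟩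
  exact key.2 g hg

theorem eq_two_of_commute (hra : M.IsRightAngled) {i a : B} {w : W}
    (hw : Commute w (cs.simple i)) (h0 : η w (cs.simple i) = 0) (ha : η w (cs.simple a) = 1) :
    M a i = 2 := by
  have hne : cs.simple a ≠ cs.simple i := by
    intro h
    rw [h, h0] at ha
    exact zero_ne_one ha
  refine η.eq_two_of_eq_one hra (fun h => hne (by rw [h])) (x := w * cs.simple i) ?_ ?_
  · rw [η.map_mul, ha, η.map_simple_of_ne, add_zero]
    intro h
    refine hne ?_
    calc cs.simple a = w * (w⁻¹ * cs.simple a * w) * w⁻¹ := by group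
      _ = cs.simple i := by rw [h, hw.eq, mul_inv_cancel_right]
  · rw [η.map_mul, h0, mul_assoc, ← hw.eq, inv_mul_cancel_left, η.map_simple_self, zero_add]

theorem simple_mul_eq_zero {i a : B} {w : W} (hM : M a i = 2) (h0 : η w (cs.simple i) = 0)
    (ha : η w (cs.simple a) = 1) : η (cs.simple a * w) (cs.simple i) = 0 := by
  rw [η.map_mul, cs.inv_simple, cs.simple_mul_comm_of_eq_two hM, cs.simple_mul_simple_cancel_right,
    h0, add_zero, η.map_simple_of_ne]
  intro h
  rw [← h, h0] at ha
  exact zero_ne_one ha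

theorem mem_closure_of_commute (hra : M.IsRightAngled) {i : B} {w : W}
    (hw : Commute w (cs.simple i)) (h0 : η w (cs.simple i) = 0) :
    w ∈ Subgroup.closure (cs.simple '' {b | M b i = 2}) := by
  induction hn : cs.length w using Nat.strong_induction_on generalizing w with
  | _ n ih =>
    by_cases h1 : w = 1
    · rw [h1]
      exact Subgroup.one_mem _
    obtain ⟨a, ha, hlt⟩ := η.exists_simple_eq_one h1
    have hM := η.eq_two_of_commute hra hw h0 ha
    have hmem := ih _ (hn ▸ hlt) (Commute.mul_left (cs.simple_mul_comm_of_eq_two hM) hw)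
      (η.simple_mul_eq_zero hM h0 ha) rfl
    rw [← cs.simple_mul_simple_cancel_left (w := w) a]
    exact Subgroup.mul_mem _ (Subgroup.subset_closure ⟨a, hM, rfl⟩) hmem

end CoxeterSystem.InversionCocycle
namespace CoxeterSystem.InversionCocycle

variable {B W : Type*} [Group W] {M : CoxeterMatrix B} {cs : CoxeterSystem M W}
variable (η : cs.InversionCocycle)

theorem simple_mem_centralizer {i a : B} (h : M a i = 2) :
    cs.simple a ∈ Subgroup.centralizer {cs.simple i} :=
  Subgroup.mem_centralizer_singleton_iff.2 (cs.simple_mul_comm_of_eq_two h)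

/-- The inversions of an element of the centralizer of a simple reflection `s i` lie in that
centralizer. -/
theorem eq_zero_of_mem_centralizer (hra : M.IsRightAngled) {i : B} {w : W}
    (hw : w ∈ Subgroup.centralizer {cs.simple i}) {g : W}
    (hg : g ∉ Subgroup.centralizer {cs.simple i}) : η w g = 0 := by
  have hi : cs.simple i ∈ Subgroup.centralizer {cs.simple i} :=
    Subgroup.mem_centralizer_singleton_iff.2 rfl
  have key : ∀ v : W, v ∈ Subgroup.centralizer {cs.simple i} → η v (cs.simple i) = 0 →
      ∀ g ∉ Subgroup.centralizer {cs.simple i}, η v g = 0 := fun v hv h0 g hg =>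
    η.eq_zero_of_mem_closure (fun b hb => simple_mem_centralizer hb)
      (η.mem_closure_of_commute hra (Subgroup.mem_centralizer_singleton_iff.1 hv) h0) hg
  rcases η.eq_zero_or_eq_one w (cs.simple i) with h0 | h1
  · exact key w hw h0 g hg
  · have hc : w * cs.simple i = cs.simple i * w := Subgroup.mem_centralizer_singleton_iff.1 hw
    have h2 : η (w * cs.simple i) (cs.simple i) = 0 := by
      rw [η.map_mul, h1, mul_assoc, ← hc, inv_mul_cancel_left, η.map_simple_self]
      rfl
    have h3 := key _ (Subgroup.mul_mem _ hw hi) h2 g hg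
    rw [η.map_mul, η.map_simple_of_ne, add_zero] at h3
    · exact h3
    · intro h
      refine hg (Subgroup.mem_centralizer_singleton_iff.2 ?_)
      rw [show g = cs.simple i by
        calc g = w * (w⁻¹ * g * w) * w⁻¹ := by group
          _ = _ := by rw [h, hc, mul_inv_cancel_right]]

/-- Let `y` be a shortest element of its double coset modulo the centralizer `C` of a simple
reflection `s i`, with a left inversion `s t`. Up to sign, the elements of `C ∩ y C y⁻¹` lie in the
standard parabolic subgroup of the generators commuting with both `s i` and `s t`. -/
theorem mem_closure_of_double_coset (hra : M.IsRightAngled) {i t : B} {y : W}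
    (hmin : ∀ c ∈ Subgroup.centralizer {cs.simple i}, ∀ c' ∈ Subgroup.centralizer {cs.simple i},
      cs.length y ≤ cs.length (c * y * c'))
    (ht : η y (cs.simple t) = 1) {w : W} (hw : w ∈ Subgroup.centralizer {cs.simple i})
    (hwy : y⁻¹ * w * y ∈ Subgroup.centralizer {cs.simple i}) (h0 : η w (cs.simple i) = 0) :
    w ∈ Subgroup.closure (cs.simple '' {b | M b i = 2 ∧ M b t = 2}) := by
  set C : Subgroup W := Subgroup.centralizer {cs.simple i} with hC
  have hy : ∀ g ∈ C, η y g = 0 := by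
    intro g hg
    refine (η.eq_zero_or_eq_one y g).resolve_right fun h => ?_
    have h2 := hmin g hg 1 C.one_mem
    rw [mul_one] at h2
    exact absurd (η.length_mul_lt h) (not_lt.2 h2)
  have hy' : ∀ g ∈ C, η y⁻¹ g = 0 := by
    intro g hg
    refine (η.eq_zero_or_eq_one y⁻¹ g).resolve_right fun h => ?_
    have h1 := η.length_mul_lt h
    have h2 := hmin 1 C.one_mem g⁻¹ (C.inv_mem hg)
    rw [one_mul, ← cs.length_inv (y * g⁻¹), mul_inv_rev, inv_inv, ← cs.length_inv y] at h2
    exact absurd h1 (not_lt.2 h2)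
  induction hn : cs.length w using Nat.strong_induction_on generalizing w with
  | _ n ih =>
    by_cases h1 : w = 1
    · rw [h1]
      exact Subgroup.one_mem _
    obtain ⟨a, ha, hlt⟩ := η.exists_simple_eq_one h1
    have hM := η.eq_two_of_commute hra (Subgroup.mem_centralizer_singleton_iff.1 hw) h0 ha
    have haC : cs.simple a ∈ C := simple_mem_centralizer hM
    have e : w * y = y * (y⁻¹ * w * y) := by group
    have h2 : η (w * y) (cs.simple a) = 1 := by
      rw [η.map_mul, ha, hy _ (C.mul_mem (C.mul_mem (C.inv_mem hw) haC) hw), add_zero]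
    have h3 : y⁻¹ * cs.simple a * y ∈ C := by
      by_contra h
      rw [e, η.map_mul, hy _ haC, η.eq_zero_of_mem_centralizer hra hwy h, add_zero] at h2
      exact zero_ne_one h2
    have h4 : y⁻¹ * cs.simple t * y ∉ C := by
      intro h
      have h5 := hy' _ h
      rw [η.map_inv, show y * (y⁻¹ * cs.simple t * y) * y⁻¹ = cs.simple t by group, ht] at h5
      exact one_ne_zero h5
    have h5 : η (w * y) (cs.simple t) = 1 := by
      rw [e, η.map_mul, ht, η.eq_zero_of_mem_centralizer hra hwy h4, add_zero]
    have hat : a ≠ t := by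
      rintro rfl
      rw [hy _ haC] at ht
      exact zero_ne_one ht
    have hMt := η.eq_two_of_eq_one hra hat h2 h5
    have hmem := ih _ (hn ▸ hlt) (η.simple_mul_eq_zero hM h0 ha) (C.mul_mem haC hw)
      (by
        have := C.mul_mem h3 hwy
        rwa [show y⁻¹ * cs.simple a * y * (y⁻¹ * w * y) = y⁻¹ * (cs.simple a * w) * y by group]
          at this) rfl
    rw [← cs.simple_mul_simple_cancel_left (w := w) a]
    exact Subgroup.mul_mem _ (Subgroup.subset_closure ⟨a, ⟨hM, hMt⟩, rfl⟩) hmem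

end CoxeterSystem.InversionCocycle

namespace CoxeterSystem

variable {B W : Type*} [Group W] {M : CoxeterMatrix B} {cs : CoxeterSystem M W}

theorem mul_self_eq_one_of_mem_closure {S : Set B} (hS : ∀ i ∈ S, ∀ j ∈ S, i ≠ j → M i j = 2)
    {w : W} (hw : w ∈ Subgroup.closure (cs.simple '' S)) : w * w = 1 := by
  have hcomm : ∀ x ∈ cs.simple '' S, ∀ y ∈ cs.simple '' S, x * y = y * x := by
    rintro _ ⟨i, hi, rfl⟩ _ ⟨j, hj, rfl⟩
    rcases eq_or_ne i j with rfl | hij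
    · rfl
    · exact cs.simple_mul_comm_of_eq_two (hS i hi j hj hij)
  have := Subgroup.isMulCommutative_closure hcomm
  induction hw using Subgroup.closure_induction with
  | mem x hx =>
    obtain ⟨b, hb, rfl⟩ := hx
    exact cs.simple_mul_simple_self b
  | one => simp
  | mul x y hx hy ihx ihy =>
    have hxy : x * y = y * x := congrArg Subtype.val
      (mul_comm' (⟨x, hx⟩ : Subgroup.closure (cs.simple '' S)) ⟨y, hy⟩)
    calc x * y * (x * y) = x * (y * x) * y := by group
      _ = (x * x) * (y * y) := by rw [← hxy]; group
      _ = 1 := by rw [ihx, ihy, mul_one]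
  | inv x _ ih => rw [← mul_inv_rev, ih, inv_one]

/-- If an element of infinite order centralizes two distinct conjugate reflections, then the
Coxeter matrix has an induced 4-cycle. -/
theorem exists_inducedFourCycle_of_commute (cs : CoxeterSystem M W) (hra : M.IsRightAngled)
    {r w x : W} (hr : cs.IsReflection r)
    (hw : ∀ n : ℕ, 0 < n → w ^ n ≠ 1) (hwr : Commute w r) (hwx : Commute w (x * r * x⁻¹))
    (hx : ¬ Commute x r) : ∃ i j k l, M.InducedFourCycle i j k l := by
  obtain ⟨η⟩ := cs.nonempty_inversionCocycle hra
  obtain ⟨g, i, rfl⟩ := hr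
  set C : Subgroup W := Subgroup.centralizer {cs.simple i} with hC
  have hmem : ∀ v, v ∈ C ↔ Commute v (cs.simple i) := fun v =>
    Subgroup.mem_centralizer_singleton_iff
  have hconj : ∀ v h : W, Commute v (h * cs.simple i * h⁻¹) ↔ h⁻¹ * v * h ∈ C := by
    intro v h
    rw [hmem]
    constructor
    · intro hv
      have := hv.map (MulAut.conj h⁻¹)
      simpa [mul_assoc] using this
    · intro hv
      have := hv.map (MulAut.conj h)
      simpa [mul_assoc] using this
  let P : W → Prop := fun y => ∃ c ∈ C, ∃ c' ∈ C, y = c * (g⁻¹ * x * g) * c'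
  obtain ⟨y, ⟨c, hc, c', hc', hyx⟩, hmin⟩ :=
    exists_minimalFor_of_wellFoundedLT P cs.length ⟨_, 1, C.one_mem, 1, C.one_mem, rfl⟩
  have hyC : y ∉ C := by
    intro hy
    have h1 : c⁻¹ * y * c'⁻¹ ∈ C := C.mul_mem (C.mul_mem (C.inv_mem hc) hy) (C.inv_mem hc')
    have h2 : g⁻¹ * x * g ∈ C := by
      rwa [hyx, show c⁻¹ * (c * (g⁻¹ * x * g) * c') * c'⁻¹ = g⁻¹ * x * g by group] at h1
    exact hx ((hconj x g).2 h2)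
  have hmin' : ∀ d ∈ C, ∀ d' ∈ C, cs.length y ≤ cs.length (d * y * d') := by
    intro d hd d' hd'
    have hP : P (d * y * d') :=
      ⟨d * c, C.mul_mem hd hc, c' * d', C.mul_mem hc' hd', by rw [hyx]; group⟩
    rcases le_total (cs.length y) (cs.length (d * y * d')) with h | h
    · exact h
    · exact hmin hP h
  set w' : W := c * (g⁻¹ * w * g) * c⁻¹ with hw'
  have h1 : g⁻¹ * w * g ∈ C := (hconj w g).1 hwr
  have h2 : (x * g)⁻¹ * w * (x * g) ∈ C := by
    refine (hconj w (x * g)).1 ?_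
    rwa [show x * g * cs.simple i * (x * g)⁻¹ = x * (g * cs.simple i * g⁻¹) * x⁻¹ by group]
  have hw'C : w' ∈ C := C.mul_mem (C.mul_mem hc h1) (C.inv_mem hc)
  have hyw' : y⁻¹ * w' * y ∈ C := by
    have := C.mul_mem (C.mul_mem (C.inv_mem hc') h2) hc'
    rwa [show c'⁻¹ * ((x * g)⁻¹ * w * (x * g)) * c' = y⁻¹ * w' * y by rw [hyx, hw']; group] at this
  obtain ⟨t, ht, hlt⟩ := η.exists_simple_eq_one fun h : y = 1 => hyC (h ▸ C.one_mem)
  have htC : cs.simple t ∉ C := by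
    intro h
    have := hmin' _ h 1 C.one_mem
    rw [mul_one] at this
    exact absurd hlt (not_lt.2 this)
  have hti : t ≠ i := by
    rintro rfl
    exact htC ((hmem _).2 (Commute.refl _))
  have hit : M i t = 0 := by
    rw [M.symmetric]
    exact (hra t i hti).resolve_right fun h =>
      htC (InversionCocycle.simple_mem_centralizer h)
  have hv0 : η (w' * w') (cs.simple i) = 0 := by
    rw [η.map_mul, mul_assoc, ← ((hmem w').1 hw'C).eq, inv_mul_cancel_left]
    exact CharTwo.add_self_eq_zero _
  have hv := η.mem_closure_of_double_coset hra hmin' ht (C.mul_mem hw'C hw'C)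
    (by
      have := C.mul_mem hyw' hyw'
      rwa [show y⁻¹ * w' * y * (y⁻¹ * w' * y) = y⁻¹ * (w' * w') * y by group] at this) hv0
  have hne : w' * w' * (w' * w') ≠ 1 := by
    intro h
    refine hw 4 (by norm_num) ?_
    have : w ^ 4 = g * c⁻¹ * (w' * w' * (w' * w')) * c * g⁻¹ := by
      simp [hw', pow_succ, mul_assoc]
    rw [this, h]
    group
  have hS : ∃ j l, (M j i = 2 ∧ M j t = 2) ∧ (M l i = 2 ∧ M l t = 2) ∧ j ≠ l ∧ M j l ≠ 2 := by
    by_contra! hS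
    exact hne (mul_self_eq_one_of_mem_closure (fun j hj l hl hjl => hS j l hj hl hjl) hv)
  obtain ⟨j, l, ⟨hji, hjt⟩, ⟨hli, hlt⟩, hjl, hM⟩ := hS
  have hd : ∀ a b, M a b = 2 → a ≠ b := by
    rintro a _ h rfl
    rw [M.diagonal] at h
    exact absurd h (by norm_num)
  refine ⟨i, j, t, l, ⟨(hd _ _ hji).symm, hti.symm, (hd _ _ hli).symm, hd _ _ hjt, hjl,
    (hd _ _ hlt).symm⟩, ?_, hjt, ?_, hli, hit, (hra j l hjl).resolve_right hM⟩
  · rw [M.symmetric, hji]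
  · rw [M.symmetric, hlt]

end CoxeterSystem

/-- A function on `ℤ × ℤ` which changes only finitely often along horizontal and vertical steps is
constant outside of a finite set. -/
theorem exists_finite_setOf_ne_of_finite {α : Type*} {f : ℤ × ℤ → α}
    (h₁ : {x | f (x + (1, 0)) ≠ f x}.Finite) (h₂ : {x | f (x + (0, 1)) ≠ f x}.Finite) :
    ∃ c, {x | f x ≠ c}.Finite := by
  have hconst : ∀ g : ℤ → α, (∀ n, g (n + 1) = g n) → ∀ m n, g m = g n := by
    intro g hg
    have h0 : ∀ n, g n = g 0 := by
      intro n
      induction n with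
      | zero => rfl
      | succ n ih => rw [hg, ih]
      | pred n ih => rw [← hg, sub_add_cancel, ih]
    exact fun m n => (h0 m).trans (h0 n).symm
  obtain ⟨u, hu⟩ := (h₁.union h₂).bddAbove
  obtain ⟨l, hl⟩ := (h₁.union h₂).bddBelow
  have hrow : ∀ b, (b < l.2 ∨ u.2 < b) → ∀ a a', f (a, b) = f (a', b) := by
    intro b hb
    refine hconst (fun a => f (a, b)) fun a => ?_
    by_contra h
    have hmem : (a, b) ∈ {x | f (x + (1, 0)) ≠ f x} ∪ {x | f (x + (0, 1)) ≠ f x} :=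
      Or.inl (by simpa using h)
    have h1 := (hu hmem).2
    have h2 := (hl hmem).2
    simp only at h1 h2
    omega
  have hcol : ∀ a, (a < l.1 ∨ u.1 < a) → ∀ b b', f (a, b) = f (a, b') := by
    intro a ha
    refine hconst (fun b => f (a, b)) fun b => ?_
    by_contra h
    have hmem : (a, b) ∈ {x | f (x + (1, 0)) ≠ f x} ∪ {x | f (x + (0, 1)) ≠ f x} :=
      Or.inr (by simpa using h)
    have h1 := (hu hmem).1
    have h2 := (hl hmem).1
    simp only at h1 h2
    omega
  refine ⟨f (u.1 + 1, u.2 + 1), (Set.finite_Icc l u).subset ?_⟩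
  rintro ⟨a, b⟩ hab
  by_contra h
  apply hab
  by_cases hb : b < l.2 ∨ u.2 < b
  · rw [hrow b hb a (u.1 + 1), hcol (u.1 + 1) (Or.inr (by omega)) b (u.2 + 1)]
  · have ha : a < l.1 ∨ u.1 < a := by
      by_contra ha
      push Not at ha hb
      exact h ⟨⟨ha.1, hb.1⟩, ⟨ha.2, hb.2⟩⟩
    rw [hcol a ha b (u.2 + 1), hrow (u.2 + 1) (Or.inr (by omega)) a (u.1 + 1)]

namespace CoxeterSystem

variable {B W : Type*} [Group W] {M : CoxeterMatrix B} {cs : CoxeterSystem M W}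

open scoped Pointwise in
/-- A right-angled Coxeter group retracts onto its standard parabolic subgroups; in particular the
word length on a finitely generated standard parabolic subgroup is proper. -/
theorem finite_setOf_mem_closure_length_le (cs : CoxeterSystem M W) (hra : M.IsRightAngled)
    {F : Set B} (hF : F.Finite) (K : ℕ) :
    {w | w ∈ Subgroup.closure (cs.simple '' F) ∧ cs.length w ≤ K}.Finite := by
  classical
  let f : B → W := fun b => if b ∈ F then cs.simple b else 1
  have hf : M.IsLiftable f := by
    refine hra.isLiftable (fun b => ?_) (fun b c hbc => ?_)
    · simp only [f]
      split_ifs <;> simp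
    · simp only [f]
      split_ifs <;> simp [cs.simple_mul_comm_of_eq_two hbc]
  set φ : W →* W := cs.lift ⟨f, hf⟩ with hφ
  have hφs : ∀ b, φ (cs.simple b) = f b := fun b => cs.lift_apply_simple hf b
  set T : Set W := insert 1 (cs.simple '' F) with hT
  have hTf : ∀ n : ℕ, (T ^ n).Finite := by
    intro n
    induction n with
    | zero => simp
    | succ n ih =>
      rw [pow_succ]
      exact ih.mul ((hF.image _).insert 1)
  have hfix : Set.EqOn φ (MonoidHom.id W) (Subgroup.closure (cs.simple '' F)) := by
    refine MonoidHom.eqOn_closure ?_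
    rintro _ ⟨b, hb, rfl⟩
    rw [hφs]
    simp [f, hb]
  have hpow : ∀ ω : List B, φ (cs.wordProd ω) ∈ T ^ ω.length := by
    intro ω
    induction ω with
    | nil => simp
    | cons b ω ih =>
      rw [cs.wordProd_cons, map_mul, hφs, List.length_cons, pow_succ']
      refine Set.mul_mem_mul ?_ ih
      simp only [f]
      split_ifs with hb
      · exact Or.inr ⟨b, hb, rfl⟩
      · exact Or.inl rfl
  refine ((Set.finite_Iic K).biUnion fun n _ => hTf n).subset ?_
  rintro w ⟨hw, hK⟩
  obtain ⟨ω, hω, rfl⟩ := cs.exists_isReduced w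
  refine Set.mem_biUnion hK ?_
  rw [hω.eq]
  have := hpow ω
  rwa [hfix hw] at this

theorem exists_finite_mem_closure (cs : CoxeterSystem M W) (w : W) :
    ∃ F : Set B, F.Finite ∧ w ∈ Subgroup.closure (cs.simple '' F) := by
  obtain ⟨ω, rfl⟩ := cs.wordProd_surjective w
  refine ⟨{b | b ∈ ω}, List.finite_toSet ω, Subgroup.list_prod_mem _ fun x hx => ?_⟩
  obtain ⟨b, hb, rfl⟩ := List.mem_map.1 hx
  exact Subgroup.subset_closure ⟨b, hb, rfl⟩

namespace InversionCocycle

variable (η : cs.InversionCocycle) {ψ : Multiplicative (ℤ × ℤ) →* W}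

/-- If `ℤ × ℤ` acts freely on the orbit of `ρ` under conjugation, then the number of left inversions
in this orbit is bounded along `ℤ × ℤ`. -/
theorem exists_card_le_of_injective {ρ : W}
    (hinj : Function.Injective fun z => ψ z * ρ * (ψ z)⁻¹) :
    ∃ K : ℕ, ∀ x, ∃ S : Finset W, S.card ≤ K ∧
      ∀ z, η (ψ x) (ψ z * ρ * (ψ z)⁻¹) = 1 → ψ z * ρ * (ψ z)⁻¹ ∈ S := by
  classical
  have hstep : ∀ e : ℤ × ℤ, {x : ℤ × ℤ | η (ψ (.ofAdd (x + e))) ρ ≠ η (ψ (.ofAdd x)) ρ}.Finite := by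
    intro e
    have hinj' : Function.Injective fun x : ℤ × ℤ =>
        ψ (.ofAdd (-x)) * ρ * (ψ (.ofAdd (-x)))⁻¹ :=
      hinj.comp (Multiplicative.ofAdd.injective.comp neg_injective)
    refine ((η.finite_setOf_eq_one (ψ (.ofAdd e))).preimage hinj'.injOn).subset fun x hx => ?_
    rw [Set.mem_ofPred_eq, ofAdd_add, _root_.map_mul, η.map_mul] at hx
    refine (η.eq_zero_or_eq_one _ _).resolve_left fun h => hx ?_
    simp only [ofAdd_neg, _root_.map_inv, inv_inv] at h
    rw [h, add_zero]
  obtain ⟨c, hc⟩ := exists_finite_setOf_ne_of_finite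
    (f := fun x => η (ψ (.ofAdd x)) ρ) (hstep (1, 0)) (hstep (0, 1))
  have hE : {x : Multiplicative (ℤ × ℤ) | η (ψ x) ρ ≠ c}.Finite :=
    hc.preimage Multiplicative.toAdd.injective.injOn
  refine ⟨hE.toFinset.card + hE.toFinset.card, fun x =>
    ⟨(hE.toFinset.image fun z => ψ z⁻¹ * ρ * (ψ z⁻¹)⁻¹) ∪
      (hE.toFinset.image fun z => ψ (x * z⁻¹) * ρ * (ψ (x * z⁻¹))⁻¹),
      (Finset.card_union_le _ _).trans (add_le_add Finset.card_image_le Finset.card_image_le),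
      fun z hz => ?_⟩⟩
  have h : η (ψ (z⁻¹ * x)) ρ = η (ψ z⁻¹) ρ + 1 := by
    rw [_root_.map_mul, η.map_mul, _root_.map_inv, inv_inv, hz]
  rw [Finset.mem_union, Finset.mem_image, Finset.mem_image]
  by_cases h1 : η (ψ z⁻¹) ρ = c
  · refine Or.inr ⟨z⁻¹ * x, ?_, ?_⟩
    · rw [Set.Finite.mem_toFinset, Set.mem_ofPred_eq, h, h1]
      simp
    · rw [mul_inv_rev, inv_inv, mul_inv_cancel_left]
  · refine Or.inl ⟨z⁻¹, ?_, ?_⟩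
    · rwa [Set.Finite.mem_toFinset]
    · rw [inv_inv]

/-- The left inversions of the elements of a copy of `ℤ × ℤ` lie in finitely many orbits under
conjugation. -/
theorem exists_finset_forall_eq_conj (ψ : Multiplicative (ℤ × ℤ) →* W) :
    ∃ N : Finset W, ∀ x g, η (ψ x) g = 1 → ∃ ρ ∈ N, ∃ z, g = ψ z * ρ * (ψ z)⁻¹ := by
  classical
  let N : Finset W := (η.finite_setOf_eq_one (ψ (.ofAdd (1, 0)))).toFinset ∪
    (η.finite_setOf_eq_one (ψ (.ofAdd (0, 1)))).toFinset
  let U : Set W := {g | ∃ ρ ∈ N, ∃ z, g = ψ z * ρ * (ψ z)⁻¹}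
  have hU : ∀ g ∉ U, ∀ z, ψ z * g * (ψ z)⁻¹ ∉ U := by
    rintro g hg z ⟨ρ, hρ, z', h⟩
    refine hg ⟨ρ, hρ, z⁻¹ * z', ?_⟩
    rw [_root_.map_mul, _root_.map_inv, mul_inv_rev, inv_inv]
    calc g = (ψ z)⁻¹ * (ψ z * g * (ψ z)⁻¹) * ψ z := by group
      _ = _ := by rw [h]; group
  let A : Subgroup (Multiplicative (ℤ × ℤ)) :=
    { carrier := {x | ∀ g ∉ U, η (ψ x) g = 0}
      one_mem' := fun g _ => by rw [_root_.map_one, η.map_one]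
      mul_mem' := fun {x y} hx hy g hg => by
        have := hU g hg x⁻¹
        rw [_root_.map_inv, inv_inv] at this
        rw [_root_.map_mul, η.map_mul, hx g hg, hy _ this, add_zero]
      inv_mem' := fun {x} hx g hg => by
        rw [_root_.map_inv, η.map_inv, hx _ (hU g hg x)] }
  have hmem : ∀ x, (∀ g, η (ψ x) g = 1 → g ∈ N) → x ∈ A := fun x hx g hg =>
    (η.eq_zero_or_eq_one _ _).resolve_right fun h => hg ⟨g, hx g h, 1, by simp⟩
  have h1 : Multiplicative.ofAdd ((1, 0) : ℤ × ℤ) ∈ A := hmem _ fun g hg => by simp [N, hg]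
  have h2 : Multiplicative.ofAdd ((0, 1) : ℤ × ℤ) ∈ A := hmem _ fun g hg => by simp [N, hg]
  refine ⟨N, fun x g hg => ?_⟩
  by_contra hgU
  have hx : x ∈ A := by
    have : x = Multiplicative.ofAdd ((1, 0) : ℤ × ℤ) ^ x.toAdd.1 *
        Multiplicative.ofAdd ((0, 1) : ℤ × ℤ) ^ x.toAdd.2 := by
      rw [← ofAdd_zsmul, ← ofAdd_zsmul, ← ofAdd_add]
      simp
    rw [this]
    exact A.mul_mem (A.zpow_mem h1 _) (A.zpow_mem h2 _)
  rw [hx g hgU] at hg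
  exact zero_ne_one hg

end InversionCocycle

/-- In a right-angled Coxeter group without induced 4-cycles, the word length is bounded on every
subgroup isomorphic to `ℤ × ℤ`. -/
theorem exists_length_le_of_injective (cs : CoxeterSystem M W) (hra : M.IsRightAngled)
    (hM : ¬ ∃ i j k l, M.InducedFourCycle i j k l) {ψ : Multiplicative (ℤ × ℤ) →* W}
    (hψ : Function.Injective ψ) : ∃ K : ℕ, ∀ x, cs.length (ψ x) ≤ K := by
  classical
  obtain ⟨η⟩ := cs.nonempty_inversionCocycle hra
  have hbound : ∀ ρ : W, ∃ K : ℕ, ∀ x, ∃ S : Finset W, S.card ≤ K ∧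
      ∀ z, η (ψ x) (ψ z * ρ * (ψ z)⁻¹) = 1 → ψ z * ρ * (ψ z)⁻¹ ∈ S := by
    intro ρ
    by_cases hρ : cs.IsReflection ρ
    swap
    · exact ⟨0, fun x => ⟨∅, le_rfl, fun z hz =>
        absurd ((cs.isReflection_conj_iff _ _).1 (η.isReflection hz)) hρ⟩⟩
    by_cases hfix : ∀ z, Commute (ψ z) ρ
    · exact ⟨1, fun x => ⟨{ρ}, by simp, fun z _ => by
        rw [(hfix z).eq, mul_inv_cancel_right, Finset.mem_singleton]⟩⟩
    push Not at hfix
    obtain ⟨x, hx⟩ := hfix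
    refine η.exists_card_le_of_injective fun y z hyz => ?_
    by_contra hne
    have hcomm : ∀ a b, Commute (ψ a) (ψ b) := fun a b => (Commute.all a b).map ψ
    have hw : Commute (ψ (z⁻¹ * y)) ρ := by
      simp only at hyz
      rw [_root_.map_mul, _root_.map_inv, commute_iff_eq, mul_assoc, inv_mul_eq_iff_eq_mul]
      calc ψ y * ρ = ψ y * ρ * (ψ y)⁻¹ * ψ y := by group
        _ = _ := by rw [hyz]; group
    refine hM (cs.exists_inducedFourCycle_of_commute hra hρ (w := ψ (z⁻¹ * y)) (x := ψ x) ?_ hw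
      (((hcomm _ _).mul_right hw).mul_right (hcomm _ _).inv_right) hx)
    intro n hn h
    rw [← map_pow, ← _root_.map_one ψ] at h
    have h0 := congrArg Multiplicative.toAdd (hψ h)
    rw [toAdd_pow, toAdd_one, smul_eq_zero] at h0
    rcases h0 with h0 | h0
    · exact hn.ne' h0
    · refine hne (inv_mul_eq_one.1 (Multiplicative.toAdd.injective h0)).symm
  choose K S hS hmem using hbound
  obtain ⟨N, hN⟩ := η.exists_finset_forall_eq_conj ψ
  refine ⟨∑ ρ ∈ N, K ρ, fun x => (η.length_le_card _ (N.biUnion fun ρ => S ρ x) ?_).trans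
    (Finset.card_biUnion_le.trans (Finset.sum_le_sum fun ρ _ => hS ρ x))⟩
  intro g hg
  obtain ⟨ρ, hρ, z, rfl⟩ := hN x g hg
  exact Finset.mem_biUnion.2 ⟨ρ, hρ, hmem ρ x z hg⟩

theorem exists_inducedFourCycle_of_injective (cs : CoxeterSystem M W) (hra : M.IsRightAngled)
    {ψ : Multiplicative (ℤ × ℤ) →* W} (hψ : Function.Injective ψ) :
    ∃ i j k l, M.InducedFourCycle i j k l := by
  by_contra hM
  obtain ⟨K, hK⟩ := cs.exists_length_le_of_injective hra hM hψ
  obtain ⟨F₁, hF₁, h₁⟩ := cs.exists_finite_mem_closure (ψ (.ofAdd (1, 0)))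
  obtain ⟨F₂, hF₂, h₂⟩ := cs.exists_finite_mem_closure (ψ (.ofAdd (0, 1)))
  have hfin := cs.finite_setOf_mem_closure_length_le hra (hF₁.union hF₂) K
  refine Set.infinite_range_of_injective hψ (hfin.subset ?_)
  rintro _ ⟨x, rfl⟩
  refine ⟨?_, hK x⟩
  have : x = Multiplicative.ofAdd ((1, 0) : ℤ × ℤ) ^ x.toAdd.1 *
      Multiplicative.ofAdd ((0, 1) : ℤ × ℤ) ^ x.toAdd.2 := by
    rw [← ofAdd_zsmul, ← ofAdd_zsmul, ← ofAdd_add]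
    simp
  rw [this, map_mul, map_zpow, map_zpow]
  refine Subgroup.mul_mem _ (Subgroup.zpow_mem _ ?_ _) (Subgroup.zpow_mem _ ?_ _)
  · exact Subgroup.closure_mono (Set.image_mono Set.subset_union_left) h₁
  · exact Subgroup.closure_mono (Set.image_mono Set.subset_union_right) h₂

end CoxeterSystem

/-- An induced 4-cycle yields a product of two infinite dihedral groups, hence a copy of
`ℤ × ℤ`. -/
theorem CoxeterSystem.exists_injective_of_inducedFourCycle {B W : Type*} [Group W]
    {M : CoxeterMatrix B} (cs : CoxeterSystem M W) (hra : M.IsRightAngled) {i j k l : B}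
    (h : M.InducedFourCycle i j k l) :
    ∃ ψ : Multiplicative (ℤ × ℤ) →* W, Function.Injective ψ := by
  classical
  obtain ⟨⟨hij, hik, hil, hjk, hjl, hkl⟩, mij, mjk, mkl, mli, mik, mjl⟩ := h
  let f : B → DihedralGroup 0 × DihedralGroup 0 := fun b =>
    if b = i then (.sr 0, 1) else if b = k then (.sr 1, 1) else
    if b = j then (1, .sr 0) else if b = l then (1, .sr 1) else 1
  have mki : M k i = 0 := by rw [M.symmetric, mik]
  have mlj : M l j = 0 := by rw [M.symmetric, mjl]
  have hf : M.IsLiftable f := by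
    refine hra.isLiftable (fun b => ?_) (fun b c hbc => ?_)
    · simp only [f]
      split_ifs <;> simp
    · simp only [f]
      split_ifs <;> subst_vars <;> simp_all
  set φ := cs.lift ⟨f, hf⟩ with hφ
  have hφs : ∀ b, φ (cs.simple b) = f b := fun b => cs.lift_apply_simple hf b
  set u : W := cs.simple i * cs.simple k with hu
  set v : W := cs.simple j * cs.simple l with hv
  have huv : Commute u v := by
    refine Commute.mul_left (Commute.mul_right ?_ ?_) (Commute.mul_right ?_ ?_)
    · exact cs.simple_mul_comm_of_eq_two mij
    · exact (cs.simple_mul_comm_of_eq_two mli).symm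
    · exact (cs.simple_mul_comm_of_eq_two mjk).symm
    · exact cs.simple_mul_comm_of_eq_two mkl
  have hφu : φ u = (.r 1, 1) := by
    rw [hu, map_mul, hφs, hφs]
    simp [f, hik.symm]
  have hφv : φ v = (1, .r 1) := by
    rw [hv, map_mul, hφs, hφs]
    simp [f, hij.symm, hil.symm, hjk, hkl.symm, hjl.symm]
  refine ⟨MonoidHom.mk' (fun x => u ^ x.toAdd.1 * v ^ x.toAdd.2) fun x y => ?_, fun x y hxy => ?_⟩
  · rw [toAdd_mul, Prod.fst_add, Prod.snd_add, zpow_add, zpow_add]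
    exact (huv.zpow_zpow _ _).mul_mul_mul_comm _ _
  · have h := congrArg φ hxy
    simp only [MonoidHom.mk'_apply, map_mul, map_zpow, hφu, hφv, Prod.pow_mk, one_zpow,
      Prod.mk_mul_mk, one_mul, mul_one, DihedralGroup.r_one_zpow, Prod.mk.injEq,
      DihedralGroup.r.injEq] at h
    exact Multiplicative.toAdd.injective (Prod.ext h.1 h.2)

/-- The Coxeter group of a right-angled Coxeter matrix `M` contains a subgroup isomorphic to
`ℤ × ℤ` if and only if some four indices form an induced 4-cycle in `M`. -/
theorem stmt12 {B : Type*} (M : CoxeterMatrix B) (hra : M.IsRightAngled) :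
    (∃ H : Subgroup M.Group, Nonempty (H ≃* Multiplicative (ℤ × ℤ))) ↔
    ∃ i j k l : B, M.InducedFourCycle i j k l := by
  constructor
  · rintro ⟨H, ⟨e⟩⟩
    exact M.toCoxeterSystem.exists_inducedFourCycle_of_injective hra
      (ψ := H.subtype.comp e.symm.toMonoidHom) (H.subtype_injective.comp e.symm.injective)
  · rintro ⟨i, j, k, l, h⟩
    obtain ⟨ψ, hψ⟩ := M.toCoxeterSystem.exists_injective_of_inducedFourCycle hra h
    exact ⟨ψ.range, ⟨(MonoidHom.ofInjective hψ).symm⟩⟩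
end
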